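/- Fix a real number N > 1 and L > 0. There exists a function ω : (0,∞) × ℝ → [0,∞], with ω(w,δ) → 0 as (w,δ) → (0,0), such that for all D ≥ 3L, all D' ∈ (0, D), every probability CD(0,N) density h on [0,D'], and every interval set E ⊆ [0, L] with m_h(E) > 0, it holds that |b(E) − D·m_h(E)^{1/N}| ≤ D·m_h(E)^{1/N}·ω(m_h(E), Res_h^D(E)) and ess sup_{t ∈ (0,1)} |h̃_E(t) − N·t^{N−1}| ≤ ω(m_h(E), Res_h^D(E)). -/

import Mathlib

open MeasureTheory
open scoped Classical ENNReal

noncomputable section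

/-- A `CD(0,N)` density on `[0, D']`: nonnegative on `[0, D']`, positive on `(0, D')`,
and `h^{1/(N-1)}` is concave on `[0, D']`. -/
def IsCDDensity (N D' : ℝ) (h : ℝ → ℝ) : Prop :=
  (∀ x ∈ Set.Icc (0:ℝ) D', 0 ≤ h x) ∧
  (∀ x ∈ Set.Ioo (0:ℝ) D', 0 < h x) ∧
  ConcaveOn ℝ (Set.Icc (0:ℝ) D') (fun x => h x ^ (1 / (N - 1)))

/-- A probability `CD(0,N)` density on `[0, D']`. -/
def IsProbCDDensity (N D' : ℝ) (h : ℝ → ℝ) : Prop :=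
  IsCDDensity N D' h ∧ (∫ x in Set.Icc (0:ℝ) D', h x) = 1

/-- A decomposition of an "interval set" `E ⊆ [0, D']`: up to a Lebesgue-null set, `E` is an at
most countable union of pairwise separated open intervals (degenerate intervals `a i = b i`
are allowed, so that finite families are covered); the summability field expresses that the
perimeter of `E` with respect to the density `h` is a (finite) real number. -/
structure IntervalDecomp (D' : ℝ) (h : ℝ → ℝ) (E : Set ℝ) where
  a : ℕ → ℝ
  b : ℕ → ℝ
  nonneg : ∀ i, 0 ≤ a i
  le : ∀ i, a i ≤ b i
  le_top : ∀ i, b i ≤ D'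
  sep : ∀ i j, i ≠ j → b i ≤ a j ∨ b j ≤ a i
  aeEq : E =ᵐ[volume] ⋃ i, Set.Ioo (a i) (b i)
  summablePerim : Summable fun i =>
    (if a i < b i ∧ a i ≠ 0 then h (a i) else 0) +
    (if a i < b i ∧ b i ≠ D' then h (b i) else 0)

/-- The weighted perimeter `P_h(E) = Σ_{i : a_i ≠ 0} h(a_i) + Σ_{i : b_i ≠ D'} h(b_i)`
of an interval set, computed from a decomposition. -/
def IntervalDecomp.perim {D' : ℝ} {h : ℝ → ℝ} {E : Set ℝ}
    (d : IntervalDecomp D' h E) : ℝ :=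
  ∑' i, ((if d.a i < d.b i ∧ d.a i ≠ 0 then h (d.a i) else 0) +
         (if d.a i < d.b i ∧ d.b i ≠ D' then h (d.b i) else 0))

/-- The essential supremum `b(E)` of a set `E ⊆ ℝ` with respect to Lebesgue measure. -/
def essSupSet (E : Set ℝ) : ℝ :=
  sInf {t : ℝ | volume (E ∩ Set.Ioi t) = 0}

/-- The normalized rescaled density `h̃_E(t) = 1_E(b(E) t) · (b(E)/m_h(E)) · h(b(E) t)`. -/
def tildeDensity (h : ℝ → ℝ) (E : Set ℝ) (t : ℝ) : ℝ :=
  Set.indicator E (fun y => (essSupSet E / (∫ x in E, h x)) * h y) (essSupSet E * t)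

structure Nice (N T : ℝ) (G : ℝ → ℝ) : Prop where
  hN : 1 < N
  hT : 0 < T
  conc : ConcaveOn ℝ (Set.Icc (0:ℝ) T) G
  nonneg : ∀ x ∈ Set.Icc (0:ℝ) T, 0 ≤ G x
  pos : ∀ x ∈ Set.Ioo (0:ℝ) T, 0 < G x
  int_one : (∫ x in (0:ℝ)..T, N * G x ^ (N - 1)) = 1

def massTo (N : ℝ) (G : ℝ → ℝ) (x : ℝ) : ℝ := ∫ y in (0:ℝ)..x, N * G y ^ (N - 1)

theorem line_integral (N c s x u v : ℝ) (hN : 1 < N) (hs : s ≠ 0) :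
    (∫ y in u..v, N * (c + s * (y - x)) ^ (N - 1)) =
      (c + s * (v - x)) ^ N / s - (c + s * (u - x)) ^ N / s := by
  have h1 : ∀ y : ℝ, HasDerivAt (fun y => (c + s * (y - x)) ^ N / s)
      (N * (c + s * (y - x)) ^ (N - 1)) y := by
    intro y
    have h0 : HasDerivAt (fun y => c + s * (y - x)) s y := by
      have := (((hasDerivAt_id y).sub_const x).const_mul s).const_add c
      simpa using this
    have h2 := (h0.rpow_const (p := N) (Or.inr hN.le)).div_const s
    exact h2.congr_deriv (by rw [div_eq_iff hs]; ring)
  rw [intervalIntegral.integral_eq_sub_of_hasDerivAt (fun y _ => h1 y)]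
  apply Continuous.intervalIntegrable
  apply Continuous.mul continuous_const
  apply Continuous.rpow_const (by fun_prop)
  intro y; right; linarith

theorem Nice.ii {N T : ℝ} {G : ℝ → ℝ} (H : Nice N T G) {u v : ℝ}
    (hu : u ∈ Set.Icc 0 T) (hv : v ∈ Set.Icc 0 T) :
    IntervalIntegrable (fun x => N * G x ^ (N - 1)) volume u v := by
  have h0 : IntervalIntegrable (fun x => N * G x ^ (N - 1)) volume 0 T := by
    by_contra hc
    have := H.int_one
    rw [intervalIntegral.integral_undef hc] at this
    norm_num at this
  apply h0.mono_set
  rw [Set.uIcc_of_le H.hT.le]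
  intro z hz
  rw [Set.mem_uIcc] at hz
  rcases hz with hz | hz
  · exact ⟨hu.1.trans hz.1, hz.2.trans hv.2⟩
  · exact ⟨hv.1.trans hz.1, hz.2.trans hu.2⟩

theorem Nice.mass_split {N T : ℝ} {G : ℝ → ℝ} (H : Nice N T G) {u v : ℝ}
    (hu : u ∈ Set.Icc 0 T) (hv : v ∈ Set.Icc 0 T) :
    (∫ y in u..v, N * G y ^ (N - 1)) = massTo N G v - massTo N G u := by
  have h0 : (0:ℝ) ∈ Set.Icc 0 T := ⟨le_rfl, H.hT.le⟩
  unfold massTo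
  rw [← intervalIntegral.integral_add_adjacent_intervals (H.ii h0 hu) (H.ii hu hv)]
  ring

theorem Nice.mass_T {N T : ℝ} {G : ℝ → ℝ} (H : Nice N T G) : massTo N G T = 1 := H.int_one

theorem Nice.mass_zero {N : ℝ} {G : ℝ → ℝ} : massTo N G 0 = 0 := by
  simp [massTo]

theorem Nice.mass_mono {N T : ℝ} {G : ℝ → ℝ} (H : Nice N T G) {u v : ℝ}
    (hu : 0 ≤ u) (huv : u ≤ v) (hv : v ≤ T) : massTo N G u ≤ massTo N G v := by
  have := H.mass_split (u := u) (v := v) ⟨hu, huv.trans hv⟩ ⟨hu.trans huv, hv⟩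
  have h2 : 0 ≤ ∫ y in u..v, N * G y ^ (N - 1) := by
    apply intervalIntegral.integral_nonneg huv
    intro y hy
    have := H.nonneg y ⟨hu.trans hy.1, hy.2.trans hv⟩
    have := H.hN
    positivity
  linarith

theorem Nice.mass_upper {N T : ℝ} {G : ℝ → ℝ} (H : Nice N T G) {u v c s x : ℝ} (hs : s ≠ 0)
    (hu : 0 ≤ u) (huv : u ≤ v) (hv : v ≤ T)
    (hle : ∀ y ∈ Set.Ioo u v, G y ≤ c + s * (y - x)) :
    massTo N G v - massTo N G u ≤ (c + s * (v - x)) ^ N / s - (c + s * (u - x)) ^ N / s := by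
  have hN := H.hN
  rw [← H.mass_split (u := u) (v := v) ⟨hu, huv.trans hv⟩ ⟨hu.trans huv, hv⟩,
    ← line_integral N c s x u v H.hN hs]
  apply intervalIntegral.integral_mono_on_of_le_Ioo huv
  · exact H.ii ⟨hu, huv.trans hv⟩ ⟨hu.trans huv, hv⟩
  · apply Continuous.intervalIntegrable
    apply Continuous.mul continuous_const
    apply Continuous.rpow_const (by fun_prop)
    intro y; right; linarith
  · intro y hy
    have := H.nonneg y ⟨hu.trans hy.1.le, hy.2.le.trans hv⟩
    have := hle y hy
    have : G y ^ (N-1) ≤ (c + s * (y - x))^(N-1) :=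
      Real.rpow_le_rpow (by assumption) (by assumption) (by linarith)
    nlinarith

/-- three point concavity, line through middle point, extrapolating -/
theorem Nice.three {N T : ℝ} {G : ℝ → ℝ} (H : Nice N T G) {u x z : ℝ}
    (hu : 0 ≤ u) (hux : u < x) (hxz : x < z) (hz : z ≤ T) :
    (G z - G x) / (z - x) ≤ (G x - G u) / (x - u) := by
  exact H.conc.slope_anti_adjacent ⟨hu, by linarith⟩ ⟨by linarith, hz⟩ hux hxz

/-- Lemma A -/
theorem Nice.sharp {N T : ℝ} {G : ℝ → ℝ} (H : Nice N T G) {x : ℝ}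
    (hx : x ∈ Set.Ioo 0 T) (hr : 0 < massTo N G x) :
    massTo N G x ^ (1 - 1 / N) - massTo N G x ≤ G x ^ (N - 1) * (T - x) := by
  have hN := H.hN
  set r := massTo N G x with hrdef
  have hk := H.pos x hx
  set k := G x with hkdef
  have hkN : 0 < k ^ N := Real.rpow_pos_of_pos hk _
  set s := k ^ N / r with hs
  have hs0 : 0 < s := by positivity
  have hks : k ^ N / s = r := by rw [hs]; field_simp
  have ex : ∃ y0, 0 ≤ y0 ∧ y0 < x ∧ k + s * (y0 - x) ≤ G y0 := by
    by_contra! hc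
    have h1 := H.mass_upper (u := 0) (v := x) (c := k) (s := s) (x := x) hs0.ne' le_rfl hx.1.le
      hx.2.le (fun y hy => (hc y hy.1.le hy.2).le)
    have h2 := hc 0 le_rfl hx.1
    have h3 := H.nonneg 0 ⟨le_rfl, H.hT.le⟩
    have h4 : 0 < (k + s * (0 - x)) ^ N / s := by
      have : 0 < (k + s * (0 - x)) := by linarith
      positivity
    rw [Nice.mass_zero, ← hrdef, sub_self, mul_zero, add_zero, hks] at h1
    linarith
  obtain ⟨y0, hy0, hy0x, hy0G⟩ := ex
  have hup : ∀ y ∈ Set.Ioo x T, G y ≤ k + s * (y - x) := by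
    intro y hy
    have h1 := H.three hy0 hy0x hy.1 hy.2.le
    have h2 : (G x - G y0) / (x - y0) ≤ s := by
      rw [div_le_iff₀ (by linarith)]
      nlinarith
    have h3 := h1.trans h2
    rw [div_le_iff₀ (by linarith [hy.1])] at h3
    linarith
  have h1 := H.mass_upper (u := x) (v := T) (c := k) (s := s) (x := x) hs0.ne' hx.1.le hx.2.le
      le_rfl hup
  rw [H.mass_T, ← hrdef, sub_self, mul_zero, add_zero, hks] at h1
  have h2 : s ≤ (k + s * (T - x)) ^ N := by
    have : 1 ≤ (k + s * (T - x)) ^ N / s := by linarith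
    rwa [le_div_iff₀ hs0, one_mul] at this
  have hTx : 0 < T - x := by linarith [hx.2]
  have hpos : 0 ≤ k + s * (T - x) := by positivity
  have h3 : s ^ (1 / N) ≤ k + s * (T - x) := by
    have := Real.rpow_le_rpow hs0.le h2 (z := 1 / N) (by positivity)
    rwa [← Real.rpow_mul hpos, mul_one_div_cancel (by linarith), Real.rpow_one] at this
  have h4 : s ^ (1 / N) = k / r ^ (1 / N) := by
    rw [hs, Real.div_rpow hkN.le hr.le, ← Real.rpow_mul hk.le, mul_one_div_cancel (by linarith),
      Real.rpow_one]
  have h5 : k ^ N = k ^ (N - 1) * k := by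
    rw [← Real.rpow_add_one hk.ne']; congr 1; ring
  have h6 : r ^ (1 - 1 / N) = r / r ^ (1 / N) := by
    rw [Real.rpow_sub hr, Real.rpow_one]
  rw [h4, hs, h5] at h3
  rw [h6]
  have h7 : r / k * (k / r ^ (1 / N)) ≤ r / k * (k + k ^ (N - 1) * k / r * (T - x)) :=
    mul_le_mul_of_nonneg_left h3 (by positivity)
  have h8 : r / k * (k / r ^ (1 / N)) = r / r ^ (1 / N) := by field_simp
  have h9 : r / k * (k + k ^ (N - 1) * k / r * (T - x)) = r + k ^ (N - 1) * (T - x) := by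
    field_simp
  linarith

theorem Nice.mirror {N T : ℝ} {G : ℝ → ℝ} (H : Nice N T G) : Nice N T (fun x => G (T - x)) where
  hN := H.hN
  hT := H.hT
  conc := by
    refine ⟨convex_Icc _ _, ?_⟩
    intro x hx y hy a b ha hb hab
    have := H.conc.2 (x := T - x) ⟨by linarith [hx.2], by linarith [hx.1]⟩
      (y := T - y) ⟨by linarith [hy.2], by linarith [hy.1]⟩ ha hb hab
    simp only [smul_eq_mul] at this ⊢
    convert this using 2
    linear_combination (-T) * hab
  nonneg := fun x hx => H.nonneg _ ⟨by linarith [hx.2], by linarith [hx.1]⟩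
  pos := fun x hx => H.pos _ ⟨by linarith [hx.2], by linarith [hx.1]⟩
  int_one := by
    rw [intervalIntegral.integral_comp_sub_left (fun x => N * G x ^ (N - 1)) T]
    simpa using H.int_one

theorem Nice.mirror_mass {N T : ℝ} {G : ℝ → ℝ} (H : Nice N T G) {x : ℝ} (hx : x ∈ Set.Icc 0 T) :
    massTo N (fun x => G (T - x)) (T - x) = 1 - massTo N G x := by
  unfold massTo
  rw [intervalIntegral.integral_comp_sub_left (fun x => N * G x ^ (N - 1)) T]
  have := H.mass_split (u := x) (v := T) hx ⟨H.hT.le, le_rfl⟩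
  rw [H.mass_T] at this
  simpa [massTo] using this

theorem Nice.sharp' {N T : ℝ} {G : ℝ → ℝ} (H : Nice N T G) {x : ℝ}
    (hx : x ∈ Set.Ioo 0 T) (hr : 0 < 1 - massTo N G x) :
    (1 - massTo N G x) ^ (1 - 1 / N) - (1 - massTo N G x) ≤ G x ^ (N - 1) * x := by
  have hm := H.mirror_mass (Set.Ioo_subset_Icc_self hx)
  have := H.mirror.sharp (x := T - x) ⟨by linarith [hx.2], by linarith [hx.1]⟩ (by rwa [hm])
  rw [hm] at this
  simpa using this

/-- Lemma T -/
theorem Nice.lineLeft {N T : ℝ} {G : ℝ → ℝ} (H : Nice N T G) (hT1 : T ≤ 1) {x s : ℝ}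
    (hx : x ∈ Set.Ioo 0 T) (hs : 0 < s) (hlt : (G x + s) ^ N / s < 1 - massTo N G x) :
    ∀ y ∈ Set.Icc 0 x, G y ≤ G x - s * (x - y) := by
  have hN := H.hN
  have hk := H.pos x hx
  have ex : ∃ z, x < z ∧ z ≤ T ∧ G x + s * (z - x) ≤ G z := by
    by_contra! hc
    have h1 := H.mass_upper (u := x) (v := T) (c := G x) (s := s) (x := x) hs.ne' hx.1.le hx.2.le
      le_rfl (fun y hy => (hc y hy.1 hy.2.le).le)
    rw [H.mass_T] at h1
    have h2 : 0 ≤ (G x + s * (x - x)) ^ N / s := by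
      rw [sub_self, mul_zero, add_zero]; positivity
    have h3 : (G x + s * (T - x)) ^ N / s ≤ (G x + s) ^ N / s := by
      have := hx.1
      have : 0 < T - x := by linarith [hx.2]
      gcongr
      nlinarith
    linarith
  obtain ⟨z, hz, hzT, hzG⟩ := ex
  intro y hy
  rcases hy.2.eq_or_lt with rfl | hyx
  · simp
  have h1 := H.three hy.1 hyx hz hzT
  have h2 : s ≤ (G z - G x) / (z - x) := by
    rw [le_div_iff₀ (by linarith)]; linarith
  have h3 := h2.trans h1
  rw [le_div_iff₀ (by linarith)] at h3
  linarith

theorem Nice.star {N T : ℝ} {G : ℝ → ℝ} (H : Nice N T G) {x y : ℝ}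
    (hy : 0 ≤ y) (hyx : y ≤ x) (hx : 0 < x) (hxT : x ≤ T) : G x * (y / x) ≤ G y := by
  have h0 := H.nonneg 0 ⟨le_rfl, H.hT.le⟩
  have hz : (0:ℝ) ∈ Set.Icc 0 T := ⟨le_rfl, H.hT.le⟩
  have hxx : x ∈ Set.Icc 0 T := ⟨hx.le, hxT⟩
  have h := H.conc.2 hz hxx (show 0 ≤ 1 - y / x by rw [sub_nonneg, div_le_one hx]; exact hyx)
    (show 0 ≤ y / x by positivity) (by ring)
  simp only [smul_eq_mul, mul_zero, zero_add] at h
  rw [div_mul_cancel₀ _ hx.ne'] at h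
  have : 0 ≤ (1 - y / x) * G 0 :=
    mul_nonneg (by rw [sub_nonneg, div_le_one hx]; exact hyx) h0
  linarith

/-- Lemma B -/
theorem Nice.mass_le {N T : ℝ} {G : ℝ → ℝ} (H : Nice N T G) {x : ℝ}
    (hx : 0 < x) (hxT : 2 * x ≤ T) (hx1 : x ≤ 1) :
    massTo N G x ≤ N * 2 ^ (N - 1) * G x ^ (N - 1) := by
  have hN := H.hN
  have hk := H.pos x ⟨hx, by linarith⟩
  have hup : ∀ y ∈ Set.Icc 0 x, G y ≤ 2 * G x := by
    intro y hy
    have h := H.mirror.star (x := T - y) (y := T - x) (by linarith) (by linarith [hy.2])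
      (by linarith [hy.2]) (by linarith [hy.1])
    simp only [sub_sub_cancel] at h
    have h1 : (1:ℝ)/2 ≤ (T - x) / (T - y) := by
      rw [div_le_div_iff₀ (by norm_num) (by linarith [hy.2])]
      linarith [hy.1]
    have := H.nonneg y ⟨hy.1, by linarith [hy.2]⟩
    nlinarith
  have h1 := H.mass_split (u := 0) (v := x) ⟨le_rfl, H.hT.le⟩ ⟨hx.le, by linarith⟩
  rw [Nice.mass_zero, sub_zero] at h1
  rw [← h1]
  have h2 : (∫ y in (0:ℝ)..x, N * G y ^ (N - 1)) ≤ ∫ y in (0:ℝ)..x, N * (2 * G x) ^ (N - 1) := by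
    apply intervalIntegral.integral_mono_on hx.le
    · exact H.ii ⟨le_rfl, H.hT.le⟩ ⟨hx.le, by linarith⟩
    · exact intervalIntegrable_const
    · intro y hy
      have := H.nonneg y ⟨hy.1, by linarith [hy.2]⟩
      have : G y ^ (N-1) ≤ (2 * G x)^(N-1) :=
        Real.rpow_le_rpow (by assumption) (hup y hy) (by linarith)
      nlinarith
  rw [intervalIntegral.integral_const, Real.mul_rpow (by norm_num) hk.le, smul_eq_mul, sub_zero] at h2
  refine h2.trans ?_
  have : 0 ≤ N * (2 ^ (N - 1) * G x ^ (N - 1)) := by positivity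
  nlinarith

/-- β^{N-1} bound -/
theorem Nice.beta_le {N T : ℝ} {G : ℝ → ℝ} (H : Nice N T G) (hT1 : T ≤ 1) {x : ℝ}
    (hx : x ∈ Set.Ioo 0 T) :
    x ^ (N - 1) * (1 - massTo N G x) ≤ G x ^ (N - 1) := by
  have hN := H.hN
  have hx0 := hx.1
  have hk := H.pos x hx
  have hs : 0 < G x / x := by positivity
  have h1 := H.mass_upper (u := x) (v := T) (c := 0) (s := G x / x) (x := 0) hs.ne' hx.1.le hx.2.le
    le_rfl (by
      intro y hy
      have := H.star hx.1.le hy.1.le (by linarith [hy.1]) hy.2.le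
      have hy0 : 0 < y := by linarith [hy.1]
      rw [zero_add, sub_zero]
      rw [mul_div_assoc', div_le_iff₀ hy0] at this
      rw [div_mul_eq_mul_div, le_div_iff₀ hx0]
      linarith)
  rw [H.mass_T] at h1
  simp only [zero_add, sub_zero] at h1
  have h2 : 0 ≤ (G x / x * x) ^ N / (G x / x) := by positivity
  have h3 : (G x / x * T) ^ N / (G x / x) ≤ (G x / x) ^ N / (G x / x) := by
    have := H.hT
    gcongr
    nlinarith
  have h4 : (G x / x) ^ N / (G x / x) = (G x / x) ^ (N - 1) := by
    rw [Real.rpow_sub hs, Real.rpow_one]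
  have h5 : 1 - massTo N G x ≤ G x ^ (N-1) / x ^ (N - 1) := by
    rw [← Real.div_rpow hk.le hx0.le]; linarith
  rw [le_div_iff₀ (by positivity)] at h5
  linarith

structure CoreData (N T β v p : ℝ) (G : ℝ → ℝ) : Prop where
  nice : Nice N T G
  T1 : T ≤ 1
  T2 : 2 / 3 ≤ T
  β0 : 0 < β
  β1 : β ≤ 1 / 3
  v0 : 0 < v
  hw : v ^ N ≤ massTo N G β
  hp : G β ^ (N - 1) ≤ p

open Filter Topology in
theorem core {ι : Type*} {l : Filter ι} {N : ℝ} (hN : 1 < N) {T β v p : ι → ℝ} {G : ι → ℝ → ℝ}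
    (C : ∀ i, CoreData N (T i) (β i) (v i) (p i) (G i))
    (hv : Tendsto v l (𝓝 0)) (hpv : Tendsto (fun i => p i / v i ^ (N - 1)) l (𝓝 1)) :
    Tendsto (fun i => β i / v i) l (𝓝 1) ∧
    Tendsto (fun i => G i (β i) ^ (N - 1) / p i) l (𝓝 1) ∧
    ∀ τ : ι → ℝ, (∀ i, τ i ∈ Set.Ioo (0:ℝ) 1) →
      Tendsto (fun i => G i (β i * τ i) / v i - τ i) l (𝓝 0) := by
  have hN0 : 0 < N - 1 := by linarith
  have hmem : ∀ i, β i ∈ Set.Ioo 0 (T i) := fun i =>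
    ⟨(C i).β0, by linarith [(C i).β1, (C i).T2]⟩
  have hGpos : ∀ i, 0 < G i (β i) := fun i => (C i).nice.pos _ (hmem i)
  set r : ι → ℝ := fun i => massTo N (G i) (β i) with hr
  have hvpos : ∀ i, 0 < v i := fun i => (C i).v0
  have hrw : ∀ i, v i ^ N ≤ r i := fun i => (C i).hw
  have hrpos : ∀ i, 0 < r i := fun i => (Real.rpow_pos_of_pos (hvpos i) N).trans_le (hrw i)
  have hvN : Tendsto (fun i => v i ^ (N - 1)) l (𝓝 0) := by
    have := hv.rpow_const (p := N - 1) (Or.inr hN0.le)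
    rwa [Real.zero_rpow hN0.ne'] at this
  have hp0 : Tendsto p l (𝓝 0) := by
    have := hpv.mul hvN
    rw [mul_zero] at this
    refine this.congr (fun i => ?_)
    have := Real.rpow_pos_of_pos (hvpos i) (N - 1)
    field_simp
  have hk0 : Tendsto (fun i => G i (β i) ^ (N - 1)) l (𝓝 0) :=
    squeeze_zero (fun i => (Real.rpow_pos_of_pos (hGpos i) _).le) (fun i => (C i).hp) hp0
  have hr0 : Tendsto r l (𝓝 0) := by
    refine squeeze_zero (fun i => (hrpos i).le) (fun i => (C i).nice.mass_le (C i).β0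
      (by linarith [(C i).β1, (C i).T2]) (by linarith [(C i).β1])) ?_
    simpa using hk0.const_mul (N * 2 ^ (N - 1))
  have hN1 : 0 < 1 / N := by positivity
  -- q
  have hq : Tendsto (fun i => G i (β i) ^ (N - 1) / v i ^ (N - 1)) l (𝓝 1) := by
    have hlow : Tendsto (fun i => 1 - r i ^ (1 / N)) l (𝓝 1) := by
      have := (hr0.rpow_const (p := 1 / N) (Or.inr hN1.le)).const_sub 1
      rwa [Real.zero_rpow hN1.ne', sub_zero] at this
    refine tendsto_of_tendsto_of_tendsto_of_le_of_le hlow hpv ?_ ?_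
    · intro i
      have h1 := (C i).nice.sharp (hmem i) (hrpos i)
      have hvp := Real.rpow_pos_of_pos (hvpos i) (N - 1)
      have hkp := Real.rpow_pos_of_pos (hGpos i) (N - 1)
      have hr1 : r i ≤ 1 := by
        have := (C i).nice.mass_mono (hmem i).1.le (hmem i).2.le le_rfl
        rwa [(C i).nice.mass_T] at this
      show 1 - r i ^ (1 / N) ≤ _
      rw [le_div_iff₀ hvp]
      have h2 : r i ^ (1 - 1 / N) - r i = r i ^ (1 - 1 / N) * (1 - r i ^ (1 / N)) := by
        rw [mul_sub, ← Real.rpow_add (hrpos i)]; simp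
      have h3 : v i ^ (N - 1) ≤ r i ^ (1 - 1 / N) := by
        have := Real.rpow_le_rpow (by positivity [hvpos i]) (hrw i)
          (show 0 ≤ 1 - 1 / N by rw [sub_nonneg, div_le_one (by linarith)]; linarith)
        rw [← Real.rpow_mul (hvpos i).le] at this
        convert this using 2
        field_simp
      have h4 : r i ^ (1 / N) ≤ 1 := Real.rpow_le_one (hrpos i).le hr1 hN1.le
      have h5 : G i (β i) ^ (N - 1) * (T i - β i) ≤ G i (β i) ^ (N - 1) := by
        have := (C i).T1
        have := (C i).β0
        nlinarith
      have h6 : v i ^ (N - 1) * (1 - r i ^ (1 / N)) ≤ r i ^ (1 - 1 / N) * (1 - r i ^ (1 / N)) :=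
        mul_le_mul_of_nonneg_right h3 (by linarith)
      change r i ^ (1 - 1 / N) - r i ≤ _ at h1
      linarith
    · intro i
      have hvp := Real.rpow_pos_of_pos (hvpos i) (N - 1)
      exact div_le_div_of_nonneg_right (C i).hp hvp.le
  -- x
  have hx : Tendsto (fun i => G i (β i) / v i) l (𝓝 1) := by
    have := hq.rpow_const (p := 1 / (N - 1)) (Or.inl one_ne_zero)
    rw [Real.one_rpow] at this
    refine this.congr (fun i => ?_)
    rw [← Real.div_rpow (hGpos i).le (hvpos i).le,
      ← Real.rpow_mul (div_nonneg (hGpos i).le (hvpos i).le), mul_one_div_cancel hN0.ne',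
      Real.rpow_one]
  have hG0 : Tendsto (fun i => G i (β i)) l (𝓝 0) := by
    have := hx.mul hv
    rw [mul_zero] at this
    refine this.congr (fun i => ?_)
    have := hvpos i
    field_simp
  -- upper bound for B
  have hBup : ∀ c > 1, ∀ᶠ i in l, β i / v i < c := by
    intro c hc
    have h1 : Tendsto (fun i => ((G i (β i) ^ (N - 1) / v i ^ (N - 1)) / (1 - r i)) ^ (1 / (N - 1)))
        l (𝓝 1) := by
      have h2 := hq.div (hr0.const_sub 1) (by norm_num)
      have := h2.rpow_const (p := 1 / (N - 1)) (Or.inl (by norm_num))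
      simpa using this
    have hr1 := hr0.eventually (gt_mem_nhds (show (0:ℝ) < 1 by norm_num))
    filter_upwards [h1.eventually (gt_mem_nhds hc), hr1] with i hi hri
    refine lt_of_le_of_lt ?_ hi
    have h3 := (C i).nice.beta_le (C i).T1 (hmem i)
    change β i ^ (N - 1) * (1 - r i) ≤ _ at h3
    have hvp := Real.rpow_pos_of_pos (hvpos i) (N - 1)
    have h4 : (β i / v i) ^ (N - 1) ≤ (G i (β i) ^ (N - 1) / v i ^ (N - 1)) / (1 - r i) := by
      rw [Real.div_rpow (C i).β0.le (hvpos i).le, le_div_iff₀ (by linarith), div_mul_eq_mul_div]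
      exact div_le_div_of_nonneg_right h3 hvp.le
    have hB0 : 0 ≤ β i / v i := div_nonneg (C i).β0.le (hvpos i).le
    have := Real.rpow_le_rpow (Real.rpow_nonneg hB0 _) h4 (show 0 ≤ 1 / (N - 1) by positivity)
    rwa [← Real.rpow_mul hB0, mul_one_div_cancel hN0.ne', Real.rpow_one] at this
  -- line
  have hline : ∀ s : ℝ, 0 < s → s < 1 → ∀ᶠ i in l, ∀ y ∈ Set.Icc 0 (β i),
      G i y ≤ G i (β i) - s * (β i - y) := by
    intro s hs hs1
    have h1 : Tendsto (fun i => (G i (β i) + s) ^ N / s - (1 - r i)) l (𝓝 (s ^ N / s - 1)) := by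
      have := (((hG0.add_const s).rpow_const (p := N) (Or.inr (by linarith))).div_const s).sub
        (hr0.const_sub 1)
      simpa using this
    have h2 : s ^ N / s - 1 < 0 := by
      have : s ^ N / s = s ^ (N - 1) := by rw [Real.rpow_sub hs, Real.rpow_one]
      rw [this]
      linarith [Real.rpow_lt_one hs.le hs1 hN0]
    filter_upwards [h1.eventually (gt_mem_nhds h2)] with i hi
    exact (C i).nice.lineLeft (C i).T1 (hmem i) hs (by change _ < 1 - r i; linarith)
  have hBlow : ∀ c < 1, ∀ᶠ i in l, c < β i / v i := by
    intro c hc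
    -- choose e
    have hcont : Tendsto (fun e : ℝ => 1 - e ^ (1 / N)) (𝓝[>] 0) (𝓝 1) := by
      have : Tendsto (fun e : ℝ => 1 - e ^ (1 / N)) (𝓝 0) (𝓝 (1 - 0 ^ (1 / N))) :=
        ((tendsto_id (x := 𝓝 (0:ℝ))).rpow_const (p := 1 / N) (Or.inr hN1.le)).const_sub 1
      rw [Real.zero_rpow hN1.ne', sub_zero] at this
      exact this.mono_left nhdsWithin_le_nhds
    obtain ⟨e, he1, he0, he2⟩ := ((hcont.eventually (lt_mem_nhds hc)).and
      (Ioo_mem_nhdsGT (show (0:ℝ) < 1 by norm_num))).exists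
    have hs : 0 < 1 - e := by linarith
    have hlim : Tendsto (fun i => G i (β i) / v i - ((G i (β i) / v i) ^ N - (1 - e)) ^ (1 / N)) l
        (𝓝 (1 - e ^ (1 / N))) := by
      have := hx.sub (((hx.rpow_const (p := N) (Or.inr (by linarith))).sub_const (1 - e)).rpow_const
        (p := 1 / N) (Or.inr hN1.le))
      simpa using this
    filter_upwards [hline (1 - e) hs (by linarith), hlim.eventually (lt_mem_nhds he1)] with i hi hi2
    refine hi2.trans_le ?_
    have hvi := hvpos i
    have hβ0 := (C i).β0
    have hG00 := (C i).nice.nonneg 0 ⟨le_rfl, (C i).nice.hT.le⟩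
    have h0 := hi 0 ⟨le_rfl, hβ0.le⟩
    have h1 := (C i).nice.mass_upper (u := 0) (v := β i) (c := G i (β i)) (s := 1 - e) (x := β i)
      hs.ne' le_rfl hβ0.le (hmem i).2.le (fun y hy => by
        have := hi y ⟨hy.1.le, hy.2.le⟩; linarith)
    rw [Nice.mass_zero, sub_self, mul_zero, add_zero, sub_zero] at h1
    change r i ≤ _ at h1
    have h2 := (hrw i).trans h1
    rw [← sub_div, le_div_iff₀ hs] at h2
    set x := G i (β i) / v i with hxdef
    set B := β i / v i with hBdef
    have hxv : G i (β i) = x * v i := by rw [hxdef]; field_simp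
    have hBv : β i = B * v i := by rw [hBdef]; field_simp
    have hB0 : 0 < B := by positivity
    have hx0 : 0 < x := div_pos (hGpos i) hvi
    have hxB : 0 ≤ x - (1 - e) * B := by
      have : 0 ≤ (x - (1 - e) * B) * v i := by
        have : (x - (1 - e) * B) * v i = G i (β i) - (1 - e) * (β i - 0) := by
          rw [hxv, hBv]; ring
        linarith
      exact nonneg_of_mul_nonneg_left this hvi
    have h3 : G i (β i) + (1 - e) * (0 - β i) = (x - (1 - e) * B) * v i := by
      rw [hxv, hBv]; ring
    rw [h3, hxv, Real.mul_rpow hxB hvi.le, Real.mul_rpow hx0.le hvi.le] at h2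
    have hvNp : 0 < v i ^ N := Real.rpow_pos_of_pos hvi N
    have h4 : (x - (1 - e) * B) ^ N ≤ x ^ N - (1 - e) := by
      have : v i ^ N * (x - (1 - e) * B) ^ N ≤ v i ^ N * (x ^ N - (1 - e)) := by linarith
      exact le_of_mul_le_mul_left this hvNp
    have h5 := Real.rpow_le_rpow (Real.rpow_nonneg hxB N) h4 hN1.le
    rw [← Real.rpow_mul hxB, mul_one_div_cancel (by linarith), Real.rpow_one] at h5
    nlinarith
  have hB : Tendsto (fun i => β i / v i) l (𝓝 1) :=
    tendsto_order.2 ⟨hBlow, fun c hc => hBup c hc⟩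
  refine ⟨hB, ?_, ?_⟩
  · have := hq.div hpv one_ne_zero
    rw [div_one] at this
    refine this.congr (fun i => ?_)
    have hvp := Real.rpow_pos_of_pos (hvpos i) (N - 1)
    simp only [Pi.div_apply]
    rw [div_div_div_cancel_right₀ hvp.ne']
  · intro τ hτ
    rw [tendsto_order]
    constructor
    · intro c hc
      filter_upwards [hx.eventually (lt_mem_nhds (show 1 + c < 1 by linarith))] with i hi
      have h1 := (C i).nice.star (x := β i) (y := β i * τ i)
        (mul_nonneg (C i).β0.le (hτ i).1.le) (by nlinarith [(C i).β0, (hτ i).2]) (C i).β0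
        (hmem i).2.le
      have hβ0 := (C i).β0
      rw [mul_div_cancel_left₀ _ hβ0.ne'] at h1
      have h2 := div_le_div_of_nonneg_right h1 (hvpos i).le
      rw [mul_div_right_comm] at h2
      have := hτ i
      nlinarith [this.1, this.2]
    · intro c hc
      set e := min (c / 4) (1 / 2) with he
      have he0 : 0 < e := by positivity
      have he1 : e ≤ 1 / 2 := min_le_right _ _
      have he2 : e ≤ c / 4 := min_le_left _ _
      filter_upwards [hline (1 - e) (by linarith) (by linarith),
        hx.eventually (gt_mem_nhds (show 1 < 1 + e by linarith)),
        hBlow (1 - e) (by linarith), hBup (1 + e) (by linarith)] with i h1 h2 h3 h4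
      have hβ0 := (C i).β0
      have hvi := hvpos i
      obtain ⟨ht0, ht1⟩ := hτ i
      have h5 := h1 (β i * τ i) ⟨by positivity, by nlinarith⟩
      have h6 := div_le_div_of_nonneg_right h5 hvi.le
      have h7 : (G i (β i) - (1 - e) * (β i - β i * τ i)) / v i =
        G i (β i) / v i - (1 - e) * (β i / v i) * (1 - τ i) := by field_simp
      rw [h7] at h6
      have h8 : (1 - e) * (1 - e) * (1 - τ i) ≤ (1 - e) * (β i / v i) * (1 - τ i) := by
        have : 0 ≤ 1 - e := by linarith
        have : 0 ≤ 1 - τ i := by linarith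
        gcongr
      have h9 : 1 - τ i - 2 * e ≤ (1 - e) * (1 - e) * (1 - τ i) := by
        have : 0 ≤ e * e * (1 - τ i) := mul_nonneg (by positivity) (by linarith)
        have : 0 ≤ e * τ i := by positivity
        nlinarith
      linarith

theorem numeric_claim (N : ℝ) (hN : 1 < N) : ∃ η > 0, η ≤ 1 / 4 ∧ ∀ u r : ℝ, 0 < u → u ≤ η →
    u ≤ r → r ≤ 3 / 4 → 9 / 10 * u ^ (1 - 1 / N) ≤ r ^ (1 - 1 / N) - r := by
  have ha : 0 < 1 - 1 / N := by rw [sub_pos, div_lt_one (by linarith)]; exact hN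
  have hN1 : 0 < 1 / N := by positivity
  set a := 1 - 1 / N with hadef
  set e : ℝ := (1 / 10) ^ N with he
  have he0 : 0 < e := by positivity
  have hq : (3 / 4 : ℝ) ^ (1 / N) < 1 := Real.rpow_lt_one (by norm_num) (by norm_num) hN1
  set c : ℝ := e ^ a * (1 - (3 / 4) ^ (1 / N)) with hc
  have hc0 : 0 < c := mul_pos (by positivity) (by linarith)
  refine ⟨min (c ^ (1 / a)) (1 / 4), by positivity, min_le_right _ _, ?_⟩
  intro u r hu huη hur hr
  have hr0 : 0 < r := by linarith
  have h2 : r ^ a - r = r ^ a * (1 - r ^ (1 / N)) := by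
    rw [mul_sub, ← Real.rpow_add hr0, hadef]; simp
  rw [h2]
  rcases le_total r e with hre | hre
  · have h3 : r ^ (1 / N) ≤ 1 / 10 := by
      have := Real.rpow_le_rpow hr0.le hre hN1.le
      rwa [he, ← Real.rpow_mul (by norm_num), mul_one_div_cancel (by linarith),
        Real.rpow_one] at this
    have h4 : u ^ a ≤ r ^ a := Real.rpow_le_rpow hu.le hur ha.le
    have h5 : 0 < u ^ a := by positivity
    nlinarith
  · have h3 : u ^ a ≤ c := by
      have := Real.rpow_le_rpow hu.le (huη.trans (min_le_left _ _)) ha.le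
      rwa [← Real.rpow_mul hc0.le, one_div_mul_cancel ha.ne', Real.rpow_one] at this
    have h4 : e ^ a ≤ r ^ a := Real.rpow_le_rpow he0.le hre ha.le
    have h5 : r ^ (1 / N) ≤ (3 / 4) ^ (1 / N) := Real.rpow_le_rpow hr0.le hr hN1.le
    have h6 : c ≤ r ^ a * (1 - r ^ (1 / N)) := by
      rw [hc]
      apply mul_le_mul h4 (by linarith) (by linarith) (by positivity)
    have h7 : 0 < u ^ a := by positivity
    linarith

theorem Nice.component {N T : ℝ} {G : ℝ → ℝ} (H : Nice N T G) {η : ℝ} (hη : η ≤ 1 / 4)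
    (hnum : ∀ u r : ℝ, 0 < u → u ≤ η →
      u ≤ r → r ≤ 3 / 4 → 9 / 10 * u ^ (1 - 1 / N) ≤ r ^ (1 - 1 / N) - r)
    {α β : ℝ} (hα : 0 ≤ α) (hαβ : α < β) (hβ : β ≤ T) (hu : massTo N G β - massTo N G α ≤ η) :
    9 / 10 * (massTo N G β - massTo N G α) ^ (1 - 1 / N) ≤
      T * ((if α ≠ 0 then G α ^ (N - 1) else 0) + (if β ≠ T then G β ^ (N - 1) else 0)) := by
  have hN := H.hN
  have ha : 0 < 1 - 1 / N := by rw [sub_pos, div_lt_one (by linarith)]; exact hN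
  have hGα := Real.rpow_nonneg (H.nonneg α ⟨hα, by linarith⟩) (N - 1)
  have hGβ := Real.rpow_nonneg (H.nonneg β ⟨by linarith, hβ⟩) (N - 1)
  have hT := H.hT
  have hA : 0 ≤ (if α ≠ 0 then G α ^ (N - 1) else 0) := by split_ifs <;> positivity
  have hB : 0 ≤ (if β ≠ T then G β ^ (N - 1) else 0) := by split_ifs <;> positivity
  have hmono := H.mass_mono hα hαβ.le hβ
  have hα1 := H.mass_mono le_rfl hα (by linarith : α ≤ T)
  have hβ1 := H.mass_mono (by linarith : 0 ≤ β) hβ le_rfl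
  rw [Nice.mass_zero] at hα1
  rw [H.mass_T] at hβ1
  rcases hmono.eq_or_lt with h0 | h0
  · rw [h0, sub_self, Real.zero_rpow ha.ne', mul_zero]; positivity
  rcases le_or_gt (massTo N G β) (3 / 4) with h1 | h1
  · have hβT : β ≠ T := by
      rintro rfl
      rw [H.mass_T] at h1; norm_num at h1
    have h2 := hnum _ (massTo N G β) (sub_pos.2 h0) hu (by linarith) h1
    have h3 := H.sharp (x := β) ⟨by linarith, lt_of_le_of_ne hβ hβT⟩ (by linarith)
    rw [if_pos hβT]
    have h4 : G β ^ (N - 1) * (T - β) ≤ T * G β ^ (N - 1) := by nlinarith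
    have h5 := mul_nonneg hT.le hA
    rw [mul_add]
    linarith
  · have hα0 : α ≠ 0 := by
      rintro rfl
      rw [Nice.mass_zero] at hu; linarith
    have h2 := hnum _ (1 - massTo N G α) (sub_pos.2 h0) hu (by linarith) (by linarith)
    have h3 := H.sharp' (x := α) ⟨lt_of_le_of_ne hα hα0.symm, by linarith⟩ (by linarith)
    rw [if_pos hα0]
    have h4 : G α ^ (N - 1) * α ≤ T * G α ^ (N - 1) := by nlinarith
    have h5 := mul_nonneg hT.le hB
    rw [mul_add]
    linarith

/-- the rescaled function -/
def scaledG (N D : ℝ) (h : ℝ → ℝ) (y : ℝ) : ℝ := (D * h (D * y) / N) ^ (1 / (N - 1))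

theorem scaledG_pow {N D D' : ℝ} {h : ℝ → ℝ} (hN : 1 < N) (hD : 0 < D) (H : IsCDDensity N D' h)
    {y : ℝ} (hy : y ∈ Set.Icc 0 (D' / D)) : scaledG N D h y ^ (N - 1) = D * h (D * y) / N := by
  have h1 : 0 ≤ h (D * y) := H.1 _ ⟨mul_nonneg hD.le hy.1, by
    have := hy.2; rw [le_div_iff₀ hD] at this; linarith⟩
  unfold scaledG
  rw [← Real.rpow_mul (by positivity), one_div_mul_cancel (by linarith), Real.rpow_one]

theorem mem_scale {D D' y : ℝ} (hD : 0 < D) (hy : y ∈ Set.Icc 0 (D' / D)) :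
    D * y ∈ Set.Icc 0 D' :=
  ⟨mul_nonneg hD.le hy.1, by have := hy.2; rw [le_div_iff₀ hD] at this; linarith⟩

theorem mem_scale' {D D' y : ℝ} (hD : 0 < D) (hy : y ∈ Set.Icc 0 D') :
    y / D ∈ Set.Icc 0 (D' / D) :=
  ⟨div_nonneg hy.1 hD.le, div_le_div_of_nonneg_right hy.2 hD.le⟩

theorem scaledG_mass {N D D' : ℝ} {h : ℝ → ℝ} (hN : 1 < N) (hD : 0 < D) (H : IsCDDensity N D' h)
    {y : ℝ} (hy : y ∈ Set.Icc 0 (D' / D)) :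
    massTo N (scaledG N D h) y = ∫ x in (0:ℝ)..(D * y), h x := by
  unfold massTo
  have : (∫ x in (0:ℝ)..y, N * scaledG N D h x ^ (N - 1)) = ∫ x in (0:ℝ)..y, D * h (D * x) := by
    apply intervalIntegral.integral_congr
    intro x hx
    rw [Set.uIcc_of_le hy.1] at hx
    simp only
    rw [scaledG_pow hN hD H ⟨hx.1, hx.2.trans hy.2⟩]
    field_simp
  rw [this, intervalIntegral.integral_const_mul,
    intervalIntegral.integral_comp_mul_left h hD.ne', mul_zero, smul_eq_mul,
    mul_inv_cancel_left₀ hD.ne']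

theorem scaledG_nice {N D D' : ℝ} {h : ℝ → ℝ} (hN : 1 < N) (hD : 0 < D) (hD' : 0 < D')
    (H : IsProbCDDensity N D' h) : Nice N (D' / D) (scaledG N D h) where
  hN := hN
  hT := by positivity
  nonneg := by
    intro x hx
    have := H.1.1 _ (mem_scale hD hx)
    unfold scaledG; positivity
  pos := by
    intro x hx
    have := H.1.2.1 (D * x) ⟨mul_pos hD hx.1, by
      have := hx.2; rw [lt_div_iff₀ hD] at this; linarith⟩
    unfold scaledG; positivity
  int_one := by
    have h0 : (0:ℝ) ≤ D' / D := by positivity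
    have := scaledG_mass hN hD H.1 (y := D' / D) ⟨h0, le_rfl⟩
    unfold massTo at this
    rw [this, mul_div_cancel₀ _ hD.ne', intervalIntegral.integral_of_le hD'.le,
      ← integral_Icc_eq_integral_Ioc]
    exact H.2
  conc := by
    refine ⟨convex_Icc _ _, ?_⟩
    intro x hx y hy a b ha hb hab
    have key : ∀ z ∈ Set.Icc 0 (D' / D), scaledG N D h z =
        (D / N) ^ (1 / (N - 1)) * h (D * z) ^ (1 / (N - 1)) := by
      intro z hz
      have := H.1.1 _ (mem_scale hD hz)
      unfold scaledG
      rw [← Real.mul_rpow (by positivity) this]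
      congr 1; ring
    have hc := (convex_Icc 0 (D' / D)) hx hy ha hb hab
    rw [key _ hx, key _ hy, key _ hc]
    have := H.1.2.2.2 (mem_scale hD hx) (mem_scale hD hy) ha hb hab
    simp only [smul_eq_mul] at this ⊢
    have h2 : D * (a * x + b * y) = a * (D * x) + b * (D * y) := by ring
    rw [h2]
    have h3 : 0 ≤ (D / N) ^ (1 / (N - 1)) := by positivity
    nlinarith [mul_le_mul_of_nonneg_left this h3]

/-- configurations -/
structure Cfg (N L : ℝ) where
  D : ℝ
  D' : ℝ
  h : ℝ → ℝ
  E : Set ℝ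
  d : IntervalDecomp D' h E
  hN : 1 < N
  hL : 0 < L
  hD : 3 * L ≤ D
  hD' : D' ∈ Set.Ioo 0 D
  hh : IsProbCDDensity N D' h
  hE : E ⊆ Set.Icc 0 L
  hw : 0 < ∫ x in E, h x

namespace Cfg
variable {N L : ℝ} (c : Cfg N L)

def w : ℝ := ∫ x in c.E, c.h x
def res : ℝ := c.D * c.d.perim / (N * c.w ^ (1 - 1 / N)) - 1
def p : ℝ := c.D * c.d.perim / N
def v : ℝ := c.w ^ (1 / N)
def G : ℝ → ℝ := scaledG N c.D c.h
def T : ℝ := c.D' / c.D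
def bb : ℝ := essSupSet c.E
def β : ℝ := c.bb / c.D
def U : Set ℝ := ⋃ i, Set.Ioo (c.d.a i) (c.d.b i)
def f (i : ℕ) : ℝ := (if c.d.a i < c.d.b i ∧ c.d.a i ≠ 0 then c.h (c.d.a i) else 0) +
         (if c.d.a i < c.d.b i ∧ c.d.b i ≠ c.D' then c.h (c.d.b i) else 0)

theorem w_pos : 0 < c.w := c.hw
theorem D_pos : 0 < c.D := by have := c.hL; have := c.hD; linarith
theorem nice : Nice N c.T c.G := scaledG_nice c.hN c.D_pos c.hD'.1 c.hh
theorem T_le : c.T ≤ 1 := by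
  unfold T; rw [div_le_one c.D_pos]; exact c.hD'.2.le
theorem v_pos : 0 < c.v := Real.rpow_pos_of_pos c.w_pos _
theorem v_pow : c.v ^ N = c.w := by
  have := c.hN
  unfold v
  rw [← Real.rpow_mul c.w_pos.le, one_div_mul_cancel (by linarith), Real.rpow_one]
theorem v_pow' : c.v ^ (N - 1) = c.w ^ (1 - 1 / N) := by
  have := c.hN
  unfold v
  rw [← Real.rpow_mul c.w_pos.le]
  congr 1; field_simp
theorem res_eq : c.p / c.v ^ (N - 1) = c.res + 1 := by
  rw [v_pow']; unfold p res
  have := c.hN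
  have := Real.rpow_pos_of_pos c.w_pos (1 - 1 / N)
  rw [div_div]; ring

theorem f_nonneg (i : ℕ) : 0 ≤ c.f i := by
  have h1 := c.hh.1.1 (c.d.a i) ⟨c.d.nonneg i, (c.d.le i).trans (c.d.le_top i)⟩
  have h2 := c.hh.1.1 (c.d.b i) ⟨(c.d.nonneg i).trans (c.d.le i), c.d.le_top i⟩
  unfold f
  split_ifs <;> positivity

theorem f_le (i : ℕ) : c.f i ≤ c.d.perim :=
  c.d.summablePerim.le_tsum i (fun j _ => c.f_nonneg j)

theorem Gpow {y : ℝ} (hy : y ∈ Set.Icc 0 c.D') : c.G (y / c.D) ^ (N - 1) = c.D * c.h y / N := by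
  have := scaledG_pow c.hN c.D_pos c.hh.1 (mem_scale' c.D_pos hy)
  rwa [mul_div_cancel₀ _ c.D_pos.ne'] at this

theorem mass_eq {y : ℝ} (hy : y ∈ Set.Icc 0 c.D') :
    massTo N c.G (y / c.D) = ∫ x in (0:ℝ)..y, c.h x := by
  have := scaledG_mass c.hN c.D_pos c.hh.1 (mem_scale' c.D_pos hy)
  rwa [mul_div_cancel₀ _ c.D_pos.ne'] at this

theorem integrable : IntegrableOn c.h (Set.Icc 0 c.D') := by
  by_contra hc
  have := c.hh.2
  rw [integral_undef hc] at this
  norm_num at this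

theorem U_sub : c.U ⊆ Set.Icc 0 c.D' := by
  intro x hx
  obtain ⟨i, hi⟩ := Set.mem_iUnion.1 hx
  exact ⟨(c.d.nonneg i).trans hi.1.le, hi.2.le.trans (c.d.le_top i)⟩

theorem w_eq : c.w = ∫ x in c.U, c.h x := setIntegral_congr_set c.d.aeEq

theorem hasSum_w : HasSum (fun i => massTo N c.G (c.d.b i / c.D) - massTo N c.G (c.d.a i / c.D))
    c.w := by
  rw [w_eq]
  have h1 : HasSum (fun i => ∫ x in Set.Ioo (c.d.a i) (c.d.b i), c.h x) (∫ x in c.U, c.h x) := by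
    apply hasSum_integral_iUnion
    · intro i; exact measurableSet_Ioo
    · intro i j hij
      apply Set.disjoint_left.2
      intro x hx hx'
      rcases c.d.sep i j hij with h | h
      · linarith [hx.2, hx'.1]
      · linarith [hx.1, hx'.2]
    · exact c.integrable.mono_set c.U_sub
  convert h1 using 2 with i
  have ha : c.d.a i ∈ Set.Icc 0 c.D' := ⟨c.d.nonneg i, (c.d.le i).trans (c.d.le_top i)⟩
  have hb : c.d.b i ∈ Set.Icc 0 c.D' := ⟨(c.d.nonneg i).trans (c.d.le i), c.d.le_top i⟩
  have hI : ∀ u ∈ Set.Icc 0 c.D', IntervalIntegrable c.h volume 0 u := by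
    intro u hu
    rw [intervalIntegrable_iff_integrableOn_Icc_of_le hu.1]
    exact c.integrable.mono_set (Set.Icc_subset_Icc_right hu.2)
  rw [c.mass_eq ha, c.mass_eq hb, intervalIntegral.integral_interval_sub_left (hI _ hb) (hI _ ha),
    intervalIntegral.integral_of_le (c.d.le i), integral_Ioc_eq_integral_Ioo]

theorem T_lower {η : ℝ} (hη : η ≤ 1 / 4)
    (hnum : ∀ u r : ℝ, 0 < u → u ≤ η →
      u ≤ r → r ≤ 3 / 4 → 9 / 10 * u ^ (1 - 1 / N) ≤ r ^ (1 - 1 / N) - r)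
    (hwη : c.w ≤ η) (hres : c.res ≤ 1 / 10) : 2 / 3 ≤ c.T := by
  have hN := c.hN
  have hD := c.D_pos
  have ha0 : 0 < 1 - 1 / N := by rw [sub_pos, div_lt_one (by linarith)]; exact hN
  have hw := c.w_pos
  have hT := c.nice.hT
  have hS := c.hasSum_w
  set wi := fun i => massTo N c.G (c.d.b i / c.D) - massTo N c.G (c.d.a i / c.D) with hwi
  have hab : ∀ i, c.d.a i / c.D ≤ c.d.b i / c.D := fun i =>
    div_le_div_of_nonneg_right (c.d.le i) hD.le
  have hbT : ∀ i, c.d.b i / c.D ≤ c.T := fun i => div_le_div_of_nonneg_right (c.d.le_top i) hD.le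
  have ha1 : ∀ i, 0 ≤ c.d.a i / c.D := fun i => div_nonneg (c.d.nonneg i) hD.le
  have hwi0 : ∀ i, 0 ≤ wi i := fun i => sub_nonneg.2 (c.nice.mass_mono (ha1 i) (hab i) (hbT i))
  have hwile : ∀ i, wi i ≤ c.w := fun i => le_hasSum hS i (fun j _ => hwi0 j)
  have hterm : ∀ i, 9 / 10 * c.w ^ (-(1 / N)) * wi i ≤ c.T * (c.D / N) * c.f i := by
    intro i
    rcases (c.d.le i).eq_or_lt with h | h
    · have h1 : wi i = 0 := by simp only [hwi]; rw [h]; ring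
      have := c.f_nonneg i
      rw [h1, mul_zero]; positivity
    have hαβ : c.d.a i / c.D < c.d.b i / c.D := div_lt_div_of_pos_right h hD
    have h1 := c.nice.component hη hnum (ha1 i) hαβ (hbT i) ((hwile i).trans hwη)
    have h2 : (if c.d.a i / c.D ≠ 0 then c.G (c.d.a i / c.D) ^ (N - 1) else 0) +
        (if c.d.b i / c.D ≠ c.T then c.G (c.d.b i / c.D) ^ (N - 1) else 0) =
        c.D / N * c.f i := by
      have ha : c.d.a i ∈ Set.Icc 0 c.D' := ⟨c.d.nonneg i, (c.d.le i).trans (c.d.le_top i)⟩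
      have hb : c.d.b i ∈ Set.Icc 0 c.D' := ⟨(c.d.nonneg i).trans (c.d.le i), c.d.le_top i⟩
      rw [c.Gpow ha, c.Gpow hb]
      have e1 : (c.d.a i / c.D ≠ 0) ↔ (c.d.a i < c.d.b i ∧ c.d.a i ≠ 0) := by
        simp [h, hD.ne']
      have e2 : (c.d.b i / c.D ≠ c.T) ↔ (c.d.a i < c.d.b i ∧ c.d.b i ≠ c.D') := by
        unfold T
        rw [Ne, div_left_inj' hD.ne']; simp [h]
      unfold f
      simp only [e1, e2]
      split_ifs <;> ring
    rw [h2] at h1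
    have h3 : c.w ^ (-(1 / N)) * wi i ≤ wi i ^ (1 - 1 / N) := by
      rcases (hwi0 i).eq_or_lt with h0 | h0
      · rw [← h0, mul_zero, Real.zero_rpow ha0.ne']
      · have e : wi i ^ (1 - 1 / N) = wi i ^ (-(1 / N)) * wi i := by
          rw [← Real.rpow_add_one h0.ne']; congr 1; ring
        rw [e]
        apply mul_le_mul_of_nonneg_right _ h0.le
        exact Real.rpow_le_rpow_of_nonpos h0 (hwile i) (by simp; linarith)
    calc 9 / 10 * c.w ^ (-(1 / N)) * wi i = 9 / 10 * (c.w ^ (-(1 / N)) * wi i) := by ring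
      _ ≤ 9 / 10 * wi i ^ (1 - 1 / N) := by linarith
      _ ≤ c.T * (c.D / N * c.f i) := h1
      _ = _ := by ring
  have hsum := hasSum_le hterm (hS.mul_left _) (c.d.summablePerim.hasSum.mul_left _)
  have hsum' : 9 / 10 * c.w ^ (-(1 / N)) * c.w ≤ c.T * (c.D / N) * c.d.perim := hsum
  have e : c.w ^ (-(1 / N)) * c.w = c.w ^ (1 - 1 / N) := by
    rw [← Real.rpow_add_one hw.ne']; congr 1; ring
  have hwa := Real.rpow_pos_of_pos hw (1 - 1 / N)
  have hp : c.p = (c.res + 1) * c.w ^ (1 - 1 / N) := by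
    rw [← c.res_eq, ← c.v_pow']
    have := Real.rpow_pos_of_pos c.v_pos (N - 1)
    field_simp
  have h4 : 9 / 10 * c.w ^ (1 - 1 / N) ≤ c.T * ((c.res + 1) * c.w ^ (1 - 1 / N)) := by
    rw [← hp, ← e]; unfold p
    calc _ = 9 / 10 * c.w ^ (-(1 / N)) * c.w := by ring
      _ ≤ _ := hsum'
      _ = _ := by ring
  have h5 : 9 / 10 ≤ c.T * (c.res + 1) := by
    apply le_of_mul_le_mul_right _ hwa
    linarith
  nlinarith

theorem exists_nondeg : ∃ i, c.d.a i < c.d.b i := by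
  by_contra! hc
  have : c.U = ∅ := by
    unfold U
    simp only [Set.iUnion_eq_empty]
    intro i; exact Set.Ioo_eq_empty (not_lt.2 (hc i))
  have h1 := c.w_eq
  rw [this] at h1
  simp at h1
  linarith [c.w_pos]

theorem upper_iff (t : ℝ) : volume (c.E ∩ Set.Ioi t) = 0 ↔
    t ∈ upperBounds {y | ∃ i, c.d.a i < c.d.b i ∧ c.d.b i = y} := by
  have h1 : volume (c.E ∩ Set.Ioi t) = volume (c.U ∩ Set.Ioi t) :=
    measure_congr (c.d.aeEq.inter (Filter.EventuallyEq.refl _ _))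
  rw [h1]
  constructor
  · rintro h0 _ ⟨i, hi, rfl⟩
    by_contra! hlt
    have hsub : Set.Ioo (max (c.d.a i) t) (c.d.b i) ⊆ c.U ∩ Set.Ioi t := by
      intro x hx
      exact ⟨Set.mem_iUnion.2 ⟨i, (le_max_left _ _).trans_lt hx.1, hx.2⟩,
        (le_max_right _ _).trans_lt hx.1⟩
    have h2 := measure_mono_null hsub h0
    rw [Real.volume_Ioo, ENNReal.ofReal_eq_zero] at h2
    have : max (c.d.a i) t < c.d.b i := max_lt hi hlt
    linarith
  · intro h
    have : c.U ∩ Set.Ioi t = ∅ := by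
      apply Set.eq_empty_of_forall_notMem
      rintro x ⟨hx, hxt⟩
      obtain ⟨i, hi⟩ := Set.mem_iUnion.1 hx
      have := h ⟨i, hi.1.trans hi.2, rfl⟩
      have : t < x := hxt
      linarith [hi.2]
    rw [this]; simp

theorem isLUB_bb : IsLUB {y | ∃ i, c.d.a i < c.d.b i ∧ c.d.b i = y} c.bb := by
  have hS : {t : ℝ | volume (c.E ∩ Set.Ioi t) = 0} =
      upperBounds {y | ∃ i, c.d.a i < c.d.b i ∧ c.d.b i = y} := by
    ext t; exact c.upper_iff t
  rw [← isGLB_upperBounds]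
  unfold bb essSupSet
  rw [hS]
  apply isGLB_csInf
  · refine ⟨c.D', ?_⟩
    rintro _ ⟨i, _, rfl⟩
    exact c.d.le_top i
  · obtain ⟨i, hi⟩ := c.exists_nondeg
    exact ⟨c.d.b i, fun t ht => ht ⟨i, hi, rfl⟩⟩

theorem bb_pos : 0 < c.bb := by
  obtain ⟨i, hi⟩ := c.exists_nondeg
  have := c.isLUB_bb.1 ⟨i, hi, rfl⟩
  linarith [c.d.nonneg i]

theorem bb_le : c.bb ≤ L := by
  apply c.isLUB_bb.2
  rw [← c.upper_iff]
  have : c.E ∩ Set.Ioi L = ∅ := by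
    apply Set.eq_empty_of_forall_notMem
    rintro x ⟨hx, hxt⟩
    have := (c.hE hx).2
    exact absurd hxt (not_lt.2 this)
  rw [this]; simp

theorem bb_le' : c.bb ≤ c.D' := by
  apply c.isLUB_bb.2
  rintro _ ⟨i, _, rfl⟩
  exact c.d.le_top i

theorem w_le : c.w ≤ massTo N c.G c.β := by
  have hb : c.bb ∈ Set.Icc 0 c.D' := ⟨c.bb_pos.le, c.bb_le'⟩
  unfold β
  rw [c.mass_eq hb, intervalIntegral.integral_of_le hb.1, ← integral_Icc_eq_integral_Ioc, c.w_eq]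
  apply setIntegral_mono_set
  · exact c.integrable.mono_set (Set.Icc_subset_Icc_right hb.2)
  · rw [Filter.EventuallyLE, ae_restrict_iff' measurableSet_Icc]
    filter_upwards with x hx
    exact c.hh.1.1 x ⟨hx.1, hx.2.trans hb.2⟩
  · apply Filter.Eventually.of_forall
    intro x hx
    obtain ⟨i, hi⟩ := Set.mem_iUnion.1 hx
    exact ⟨(c.d.nonneg i).trans hi.1.le,
      hi.2.le.trans (c.isLUB_bb.1 ⟨i, hi.1.trans hi.2, rfl⟩)⟩

theorem near (hb : c.bb < c.D') {ε t : ℝ} (hε : 0 < ε) (ht : t < c.bb) :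
    ∃ i, c.d.a i < c.d.b i ∧ t < c.d.b i ∧ c.d.b i ≤ c.bb ∧
      c.G c.β ^ (N - 1) - ε ≤ c.D * c.h (c.d.b i) / N := by
  have hD := c.D_pos
  have hN := c.hN
  have hmem : c.β ∈ Set.Ioo 0 c.T := ⟨div_pos c.bb_pos hD, div_lt_div_of_pos_right hb hD⟩
  have hcont : ContinuousAt (fun y => c.G (y / c.D) ^ (N - 1)) c.bb := by
    have h1 := c.nice.conc.continuousOn_interior
    rw [interior_Icc] at h1
    have h2 : ContinuousAt c.G (c.bb / c.D) := h1.continuousAt (isOpen_Ioo.mem_nhds hmem)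
    have h3 : ContinuousAt (fun y => c.G (y / c.D)) c.bb :=
      ContinuousAt.comp (f := fun y => y / c.D) h2 (by fun_prop)
    exact h3.rpow_const (Or.inr (by linarith))
  have hev := hcont.eventually (lt_mem_nhds
    (show c.G (c.bb / c.D) ^ (N - 1) - ε < c.G (c.bb / c.D) ^ (N - 1) by linarith))
  obtain ⟨l, u, ⟨hl, hu⟩, hlu⟩ := mem_nhds_iff_exists_Ioo_subset.1 hev
  have hlt : max l t < c.bb := max_lt hl ht
  obtain ⟨_, ⟨i, hi, rfl⟩, h1, h2⟩ := c.isLUB_bb.exists_between hlt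
  refine ⟨i, hi, (le_max_right _ _).trans_lt h1, h2, ?_⟩
  have h3 := hlu ⟨(le_max_left _ _).trans_lt h1, h2.trans_lt hu⟩
  simp only [Set.mem_ofPred_eq] at h3
  rw [c.Gpow ⟨(c.d.nonneg i).trans (c.d.le i), c.d.le_top i⟩] at h3
  exact h3.le

theorem p_ge (hb : c.bb < c.D') : c.G c.β ^ (N - 1) ≤ c.p := by
  have hD := c.D_pos
  have hN := c.hN
  apply le_of_forall_pos_le_add
  intro ε hε
  obtain ⟨i, hi, -, hib, h1⟩ := c.near hb hε (t := 0) c.bb_pos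
  have h2 := c.f_le i
  have h3 : c.h (c.d.b i) ≤ c.f i := by
    have ha := c.hh.1.1 (c.d.a i) ⟨c.d.nonneg i, (c.d.le i).trans (c.d.le_top i)⟩
    unfold f
    rw [if_pos (c := _ ∧ c.d.b i ≠ _) ⟨hi, (hib.trans_lt hb).ne⟩]
    split_ifs <;> linarith
  have h4 : c.D * c.h (c.d.b i) / N ≤ c.p := by
    unfold p
    gcongr
    linarith
  linarith

theorem p_ge_of_notMem (hb : c.bb < c.D') {τ : ℝ} (hτ : τ ∈ Set.Ioo (0:ℝ) 1)
    (hU : c.bb * τ ∉ c.U) : c.G c.β ^ (N - 1) * (1 + τ ^ (N - 1)) ≤ c.p := by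
  have hD := c.D_pos
  have hN := c.hN
  have hb0 := c.bb_pos
  have hmem : c.β ∈ Set.Ioo 0 c.T := ⟨div_pos c.bb_pos hD, div_lt_div_of_pos_right hb hD⟩
  apply le_of_forall_pos_le_add
  intro ε hε
  obtain ⟨i, hi, hti, hib, h1⟩ := c.near hb hε (t := c.bb * τ) (by nlinarith [hτ.2])
  have hai : c.bb * τ ≤ c.d.a i := by
    by_contra! hc
    exact hU (Set.mem_iUnion.2 ⟨i, hc, hti⟩)
  have ha0 : 0 < c.d.a i := (mul_pos hb0 hτ.1).trans_le hai
  have h2 := c.f_le i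
  have h3 : c.h (c.d.a i) + c.h (c.d.b i) = c.f i := by
    unfold f
    rw [if_pos ⟨hi, ha0.ne'⟩, if_pos ⟨hi, (hib.trans_lt hb).ne⟩]
  have h4 : c.D * (c.h (c.d.a i) + c.h (c.d.b i)) / N ≤ c.p := by
    unfold p
    gcongr
    linarith
  have hGp := c.nice.pos _ hmem
  have h5 := c.nice.star (x := c.β) (y := c.d.a i / c.D) (div_nonneg ha0.le hD.le)
    (div_le_div_of_nonneg_right (hi.le.trans hib) hD.le) hmem.1 hmem.2.le
  have h6 : τ ≤ c.d.a i / c.D / c.β := by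
    unfold β
    rw [div_div_div_cancel_right₀ hD.ne', le_div_iff₀ hb0]; linarith
  have h7 : c.G c.β * τ ≤ c.G (c.d.a i / c.D) :=
    (mul_le_mul_of_nonneg_left h6 hGp.le).trans h5
  have h8 := Real.rpow_le_rpow (mul_nonneg hGp.le hτ.1.le) h7 (show 0 ≤ N - 1 by linarith)
  rw [Real.mul_rpow hGp.le hτ.1.le,
    c.Gpow ⟨c.d.nonneg i, (c.d.le i).trans (c.d.le_top i)⟩] at h8
  have h9 : c.D * (c.h (c.d.a i) + c.h (c.d.b i)) / N =
    c.D * c.h (c.d.a i) / N + c.D * c.h (c.d.b i) / N := by ring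
  linarith

theorem bb_lt (hT : 2 / 3 ≤ c.T) : c.bb < c.D' := by
  have hD := c.D_pos
  unfold T at hT
  rw [le_div_iff₀ hD] at hT
  have := c.bb_le
  have := c.hD
  have := c.hL
  linarith

theorem coreData (hT : 2 / 3 ≤ c.T) : CoreData N c.T c.β c.v c.p c.G where
  nice := c.nice
  T1 := c.T_le
  T2 := hT
  β0 := div_pos c.bb_pos c.D_pos
  β1 := by
    unfold β
    rw [div_le_iff₀ c.D_pos]
    have := c.bb_le
    have := c.hD
    linarith
  v0 := c.v_pos
  hw := by rw [c.v_pow]; exact c.w_le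
  hp := c.p_ge (c.bb_lt hT)

end Cfg

section Final

open Filter Topology

theorem rpow_diff_tendsto {ι : Type*} {l : Filter ι} {a : ℝ} (ha : 0 < a) {X τ : ι → ℝ}
    (hX : ∀ i, 0 ≤ X i) (hτ : ∀ i, τ i ∈ Set.Ioo (0:ℝ) 1)
    (h : Tendsto (fun i => X i - τ i) l (𝓝 0)) :
    Tendsto (fun i => X i ^ a - τ i ^ a) l (𝓝 0) := by
  have hc : ContinuousOn (fun x : ℝ => x ^ a) (Set.Icc 0 2) :=
    (Real.continuous_rpow_const ha.le).continuousOn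
  have hu := isCompact_Icc.uniformContinuousOn_of_continuous hc
  rw [Metric.uniformContinuousOn_iff] at hu
  rw [Metric.tendsto_nhds] at h ⊢
  intro ε hε
  obtain ⟨δ, hδ, hd⟩ := hu ε hε
  filter_upwards [h δ hδ, h 1 one_pos] with i h1 h2
  rw [Real.dist_eq, sub_zero] at h1 h2 ⊢
  have ht := hτ i
  rw [abs_lt] at h2
  have := hd (X i) ⟨hX i, by linarith [ht.2, h2.2]⟩ (τ i) ⟨ht.1.le, by linarith [ht.2]⟩
    (by rwa [Real.dist_eq])
  rwa [Real.dist_eq] at this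

def baseF : Filter (ℝ × ℝ) := nhdsWithin ((0:ℝ), (0:ℝ)) {p : ℝ × ℝ | 0 < p.1}

theorem cfg_core {N L : ℝ} (hN : 1 < N) {ι : Type*} {l : Filter ι} {c : ι → Cfg N L}
    (hT : ∀ i, 2 / 3 ≤ (c i).T) (hl : Tendsto (fun i => ((c i).w, (c i).res)) l baseF) :
    Tendsto (fun i => (c i).β / (c i).v) l (𝓝 1) ∧
    Tendsto (fun i => (c i).G (c i).β ^ (N - 1) / (c i).p) l (𝓝 1) ∧
    ∀ τ : ι → ℝ, (∀ i, τ i ∈ Set.Ioo (0:ℝ) 1) →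
      Tendsto (fun i => (c i).G ((c i).β * τ i) / (c i).v - τ i) l (𝓝 0) := by
  have hl' : Tendsto (fun i => ((c i).w, (c i).res)) l (𝓝 ((0:ℝ), (0:ℝ))) :=
    hl.mono_right nhdsWithin_le_nhds
  have hw : Tendsto (fun i => (c i).w) l (𝓝 0) := (continuous_fst.tendsto _).comp hl'
  have hr : Tendsto (fun i => (c i).res) l (𝓝 0) := (continuous_snd.tendsto _).comp hl'
  have hN1 : 0 < 1 / N := by positivity
  apply core hN (fun i => (c i).coreData (hT i))
  · have := hw.rpow_const (p := 1 / N) (Or.inr hN1.le)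
    rwa [Real.zero_rpow hN1.ne'] at this
  · have := hr.add_const 1
    rw [zero_add] at this
    exact this.congr (fun i => ((c i).res_eq).symm)

theorem cfg_tilde {N L : ℝ} (c : Cfg N L) (hT : 2 / 3 ≤ c.T) {τ : ℝ} (hτ : τ ∈ Set.Ioo (0:ℝ) 1)
    (hEU : c.bb * τ ∈ c.E ↔ c.bb * τ ∈ c.U) :
    |tildeDensity c.h c.E τ - N * τ ^ (N - 1)| ≤
      N * |c.β / c.v - 1| * (|(c.G (c.β * τ) / c.v) ^ (N - 1) - τ ^ (N - 1)| + 1) +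
      N * |(c.G (c.β * τ) / c.v) ^ (N - 1) - τ ^ (N - 1)| +
      N * |(c.G c.β ^ (N - 1) / c.p)⁻¹ - 1| := by
  have hN := c.hN
  have hD := c.D_pos
  have hv := c.v_pos
  have hb0 := c.bb_pos
  have hb := c.bb_lt hT
  have hmem : c.β ∈ Set.Ioo 0 c.T := ⟨div_pos c.bb_pos hD, div_lt_div_of_pos_right hb hD⟩
  have hτa0 : 0 ≤ τ ^ (N - 1) := Real.rpow_nonneg hτ.1.le _
  have hτa1 : τ ^ (N - 1) ≤ 1 := Real.rpow_le_one hτ.1.le hτ.2.le (by linarith)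
  set Y := (c.G (c.β * τ) / c.v) ^ (N - 1) - τ ^ (N - 1) with hY
  by_cases hE : c.bb * τ ∈ c.E
  · have e1 : tildeDensity c.h c.E τ = c.bb / c.w * c.h (c.bb * τ) := by
      unfold tildeDensity
      exact Set.indicator_of_mem hE _
    have hbτ : c.bb * τ ∈ Set.Icc 0 c.D' :=
      ⟨mul_nonneg hb0.le hτ.1.le, by nlinarith [hτ.2]⟩
    have e2 := c.Gpow hbτ
    have e3 : c.bb * τ / c.D = c.β * τ := by unfold Cfg.β; ring
    rw [e3] at e2
    have hG0 : 0 ≤ c.G (c.β * τ) := by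
      rw [← e3]; exact c.nice.nonneg _ (mem_scale' hD hbτ)
    have hvp := Real.rpow_pos_of_pos hv (N - 1)
    have e4 : tildeDensity c.h c.E τ = N * (c.β / c.v) * (Y + τ ^ (N - 1)) := by
      rw [e1, hY, sub_add_cancel, Real.div_rpow hG0 hv.le, e2, ← c.v_pow]
      have : c.v ^ N = c.v ^ (N - 1) * c.v := by
        rw [← Real.rpow_add_one hv.ne']; congr 1; ring
      rw [this]
      unfold Cfg.β
      field_simp
    have e5 : tildeDensity c.h c.E τ - N * τ ^ (N - 1) =
        N * (c.β / c.v - 1) * (Y + τ ^ (N - 1)) + N * Y := by rw [e4]; ring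
    rw [e5]
    have h1 : |N * (c.β / c.v - 1) * (Y + τ ^ (N - 1))| ≤ N * |c.β / c.v - 1| * (|Y| + 1) := by
      rw [abs_mul, abs_mul, abs_of_pos (by linarith : 0 < N)]
      gcongr
      exact (abs_add_le _ _).trans (by rw [abs_of_nonneg hτa0]; linarith)
    have h2 : |N * Y| = N * |Y| := by rw [abs_mul, abs_of_pos (by linarith : 0 < N)]
    have h3 : 0 ≤ N * |(c.G c.β ^ (N - 1) / c.p)⁻¹ - 1| := by positivity
    have h4 := abs_add_le (N * (c.β / c.v - 1) * (Y + τ ^ (N - 1))) (N * Y)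
    linarith
  · have e1 : tildeDensity c.h c.E τ = 0 := by
      unfold tildeDensity
      exact Set.indicator_of_notMem hE _
    have h1 := c.p_ge_of_notMem hb hτ (fun hh => hE (hEU.2 hh))
    have hGp := Real.rpow_pos_of_pos (c.nice.pos _ hmem) (N - 1)
    have h2 : τ ^ (N - 1) ≤ (c.G c.β ^ (N - 1) / c.p)⁻¹ - 1 := by
      rw [inv_div, le_sub_iff_add_le, le_div_iff₀ hGp]
      linarith
    rw [e1, zero_sub, abs_neg, abs_of_nonneg (by positivity)]
    have h3 : N * τ ^ (N - 1) ≤ N * |(c.G c.β ^ (N - 1) / c.p)⁻¹ - 1| := by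
      gcongr
      exact h2.trans (le_abs_self _)
    have h4 : 0 ≤ N * |c.β / c.v - 1| * (|Y| + 1) + N * |Y| := by positivity
    linarith

theorem cfg_ev {N L : ℝ} (hN : 1 < N) {ε : ℝ} (hε : 0 < ε) :
    ∀ᶠ q in baseF, ∀ c : Cfg N L, (c.w, c.res) = q →
      |c.bb - c.D * c.v| ≤ ε * (c.D * c.v) ∧
      ∀ τ ∈ Set.Ioo (0:ℝ) 1, (c.bb * τ ∈ c.E ↔ c.bb * τ ∈ c.U) →
        |tildeDensity c.h c.E τ - N * τ ^ (N - 1)| ≤ ε := by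
  obtain ⟨η, hη, hη4, hnum⟩ := numeric_claim N hN
  have hevT : ∀ᶠ q in baseF, ∀ c : Cfg N L, (c.w, c.res) = q → 2 / 3 ≤ c.T := by
    have h1 : ∀ᶠ q : ℝ × ℝ in 𝓝 ((0:ℝ), (0:ℝ)), q.1 < η ∧ q.2 < 1 / 10 := by
      have a1 := (continuous_fst.tendsto ((0:ℝ), (0:ℝ))).eventually (gt_mem_nhds hη)
      have a2 := (continuous_snd.tendsto ((0:ℝ), (0:ℝ))).eventually
        (gt_mem_nhds (show (0:ℝ) < 1 / 10 by norm_num))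
      exact a1.and a2
    filter_upwards [nhdsWithin_le_nhds h1] with q hq c hc
    subst hc
    exact c.T_lower hη4 hnum hq.1.le hq.2.le
  have hev1 : ∀ᶠ q in baseF, ∀ c : {c : Cfg N L // 2 / 3 ≤ c.T}, (c.1.w, c.1.res) = q →
      |c.1.β / c.1.v - 1| < ε := by
    rw [← eventually_comap]
    have := (cfg_core hN (c := fun c : {c : Cfg N L // 2 / 3 ≤ c.T} => c.1) (fun i => i.2)
      tendsto_comap).1
    rw [Metric.tendsto_nhds] at this
    simpa [Real.dist_eq] using this ε hε
  have hev2 : ∀ᶠ q in baseF, ∀ c : {c : Cfg N L × ℝ // 2 / 3 ≤ c.1.T ∧ c.2 ∈ Set.Ioo (0:ℝ) 1 ∧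
        (c.1.bb * c.2 ∈ c.1.E ↔ c.1.bb * c.2 ∈ c.1.U)}, (c.1.1.w, c.1.1.res) = q →
      |tildeDensity c.1.1.h c.1.1.E c.1.2 - N * c.1.2 ^ (N - 1)| < ε := by
    rw [← eventually_comap]
    obtain ⟨h1, h2, h3⟩ := cfg_core hN (c := fun c : {c : Cfg N L × ℝ // 2 / 3 ≤ c.1.T ∧
      c.2 ∈ Set.Ioo (0:ℝ) 1 ∧
        (c.1.bb * c.2 ∈ c.1.E ↔ c.1.bb * c.2 ∈ c.1.U)} => c.1.1) (fun i => i.2.1)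
      tendsto_comap
    have h4 := rpow_diff_tendsto (a := N - 1) (by linarith) (fun i => by
      have hD := i.1.1.D_pos
      refine div_nonneg (i.1.1.nice.nonneg _ ?_) i.1.1.v_pos.le
      have hb := i.1.1.bb_pos
      have ht := i.2.2.1
      have hle := i.1.1.bb_le'
      constructor
      · exact mul_nonneg (div_nonneg hb.le hD.le) ht.1.le
      · unfold Cfg.β Cfg.T
        rw [div_mul_eq_mul_div]
        apply div_le_div_of_nonneg_right _ hD.le
        nlinarith [ht.2]) (fun i => i.2.2.1) (h3 (fun i => i.1.2) (fun i => i.2.2.1))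
    have h5 := (((h1.sub_const 1).abs.const_mul N).mul (h4.abs.add_const 1)).add
      (h4.abs.const_mul N) |>.add (((h2.inv₀ one_ne_zero).sub_const 1).abs.const_mul N)
    simp only [sub_self, abs_zero, mul_zero, zero_mul, add_zero, inv_one] at h5
    filter_upwards [h5.eventually (gt_mem_nhds hε)] with i hi
    exact (cfg_tilde i.1.1 i.2.1 i.2.2.1 i.2.2.2).trans_lt hi
  filter_upwards [hevT, hev1, hev2] with q g1 g2 g3 c hc
  have hT := g1 c hc
  refine ⟨?_, ?_⟩
  · have h := g2 ⟨c, hT⟩ hc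
    simp only at h
    have hD := c.D_pos
    have hv := c.v_pos
    have e : c.bb - c.D * c.v = (c.β / c.v - 1) * (c.D * c.v) := by
      unfold Cfg.β; field_simp
    rw [e, abs_mul, abs_of_pos (by positivity : 0 < c.D * c.v)]
    exact mul_le_mul_of_nonneg_right h.le (by positivity)
  · intro τ hτ hEU
    exact (g3 ⟨(c, τ), hT, hτ, hEU⟩ hc).le

theorem cfg_ae {N L : ℝ} (c : Cfg N L) :
    ∀ᵐ τ : ℝ, (c.bb * τ ∈ c.E ↔ c.bb * τ ∈ c.U) := by
  have h := c.d.aeEq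
  have hq : Measure.QuasiMeasurePreserving (fun τ : ℝ => c.bb * τ) volume volume := by
    refine ⟨by fun_prop, ?_⟩
    rw [Real.map_volume_mul_left c.bb_pos.ne']
    exact Measure.smul_absolutelyContinuous
  have h2 := hq.ae (Filter.eventuallyEq_set.1 h)
  exact h2

end Final

/-- Theorem 5.11 (summary of the one-dimensional analysis): there is a modulus
`ω : (0,∞) × ℝ → [0,∞]`, infinitesimal as `(w, δ) → (0,0)`, such that
`|b(E) - D m_h(E)^{1/N}| ≤ D m_h(E)^{1/N} ω(m_h(E), Res_h^D(E))` and
`ess sup_{t ∈ (0,1)} |h̃_E(t) - N t^{N-1}| ≤ ω(m_h(E), Res_h^D(E))`. -/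
theorem one_dimensional_rigidity_summary (N L : ℝ) (hN : 1 < N) (hL : 0 < L) :
    ∃ ω : ℝ × ℝ → ℝ≥0∞,
      Filter.Tendsto ω (nhdsWithin ((0:ℝ), (0:ℝ)) {p : ℝ × ℝ | 0 < p.1})
        (nhds 0) ∧
      ∀ D D' : ℝ, 3 * L ≤ D → D' ∈ Set.Ioo (0:ℝ) D →
      ∀ h : ℝ → ℝ, IsProbCDDensity N D' h →
      ∀ E : Set ℝ, E ⊆ Set.Icc 0 L →
      ∀ d : IntervalDecomp D' h E,
        0 < (∫ x in E, h x) →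
        (ENNReal.ofReal |essSupSet E - D * (∫ x in E, h x) ^ (1 / N)| ≤
            ENNReal.ofReal (D * (∫ x in E, h x) ^ (1 / N)) *
              ω ((∫ x in E, h x),
                 D * d.perim / (N * (∫ x in E, h x) ^ (1 - 1 / N)) - 1) ∧
          essSup (fun t => ENNReal.ofReal |tildeDensity h E t - N * t ^ (N - 1)|)
              (volume.restrict (Set.Ioo (0:ℝ) 1)) ≤
            ω ((∫ x in E, h x),
               D * d.perim / (N * (∫ x in E, h x) ^ (1 - 1 / N)) - 1)) := by
  let Q : Cfg N L → ℝ≥0∞ := fun c =>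
    max (ENNReal.ofReal (|c.bb - c.D * c.v| / (c.D * c.v)))
      (essSup (fun t => ENNReal.ofReal |tildeDensity c.h c.E t - N * t ^ (N - 1)|)
              (volume.restrict (Set.Ioo (0:ℝ) 1)))
  refine ⟨fun q => ⨆ c : Cfg N L, ⨆ _ : (c.w, c.res) = q, Q c, ?_, ?_⟩
  · rw [ENNReal.tendsto_nhds_zero]
    intro ε hε
    obtain ⟨e, he0, heε⟩ : ∃ e : ℝ, 0 < e ∧ ENNReal.ofReal e ≤ ε := by
      rcases eq_or_ne ε ⊤ with rfl | hne
      · exact ⟨1, one_pos, le_top⟩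
      · exact ⟨ε.toReal, ENNReal.toReal_pos hε.ne' hne, ENNReal.ofReal_toReal_le⟩
    have := cfg_ev (L := L) hN he0
    filter_upwards [this] with q hq
    refine iSup_le fun c => iSup_le fun hc => ?_
    obtain ⟨h1, h2⟩ := hq c hc
    refine le_trans (max_le ?_ ?_) heε
    · apply ENNReal.ofReal_le_ofReal
      rw [div_le_iff₀ (mul_pos c.D_pos c.v_pos)]
      exact h1
    · refine essSup_le_of_ae_le _ ?_
      have := ae_restrict_of_ae (s := Set.Ioo (0:ℝ) 1) (cfg_ae c)
      filter_upwards [this, ae_restrict_mem measurableSet_Ioo] with t ht1 ht2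
      exact ENNReal.ofReal_le_ofReal (h2 t ht2 ht1)
  · intro D D' hD hD' h hh E hE d hw
    let c : Cfg N L := ⟨D, D', h, E, d, hN, hL, hD, hD', hh, hE, hw⟩
    have hle : Q c ≤ ⨆ c' : Cfg N L, ⨆ _ : (c'.w, c'.res) = (c.w, c.res), Q c' :=
      le_iSup₂_of_le c rfl le_rfl
    refine ⟨?_, (le_max_right _ _).trans hle⟩
    have h1 := (le_max_left _ _).trans hle
    have hpos : 0 < c.D * c.v := mul_pos c.D_pos c.v_pos
    have e : ENNReal.ofReal |c.bb - c.D * c.v| = ENNReal.ofReal (c.D * c.v) *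
        ENNReal.ofReal (|c.bb - c.D * c.v| / (c.D * c.v)) := by
      rw [← ENNReal.ofReal_mul hpos.le, mul_div_cancel₀ _ hpos.ne']
    change ENNReal.ofReal |c.bb - c.D * c.v| ≤ ENNReal.ofReal (c.D * c.v) * _
    rw [e]
    exact mul_le_mul_right h1 _
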